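/- (Derivative of the building blocks) Let ℓ ∈ ℕ and let X : ℝ → M be a function into a real Banach algebra (e.g. square real matrices of fixed size) that is differentiable at t ∈ ℝ with derivative X'(t). Then the function s ↦ Γ_ℓ(X(s)) is differentiable at t and its derivative equals Γ_ℓ(X(t), X'(t), X(t)). -/

import Mathlib

/-- `Γ_ℓ(X) = ∑_{m=0}^∞ X^m / (ℓ+m)!` in a real Banach algebra. -/
noncomputable def Gamma {A : Type*} [NormedRing A] [NormedAlgebra ℝ A] (ℓ : ℕ) (X : A) : A :=
  ∑' m : ℕ, (((ℓ + m).factorial : ℝ))⁻¹ • X ^ m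

/-- `Γ_ℓ(X, Y, Z) = ∑_{m=0}^∞ ∑_{n=0}^∞ X^m Y Z^n / (ℓ+m+n+1)!` in a real Banach algebra. -/
noncomputable def Gamma3 {A : Type*} [NormedRing A] [NormedAlgebra ℝ A]
    (ℓ : ℕ) (X Y Z : A) : A :=
  ∑' m : ℕ, ∑' n : ℕ, (((ℓ + m + n + 1).factorial : ℝ))⁻¹ • (X ^ m * Y * Z ^ n)

section GammaSeries

open Finset
open scoped RightActions

variable {A : Type*} [NormedRing A]

/-- A bound on powers that does not require `‖1‖ = 1`. -/
theorem norm_pow_le_norm_one_mul (Y : A) (n : ℕ) : ‖Y ^ n‖ ≤ ‖(1 : A)‖ * ‖Y‖ ^ n := by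
  induction n with
  | zero => simp
  | succ n ih =>
    calc ‖Y ^ (n + 1)‖ ≤ ‖Y ^ n‖ * ‖Y‖ := by rw [pow_succ]; exact norm_mul_le _ _
      _ ≤ ‖(1 : A)‖ * ‖Y‖ ^ n * ‖Y‖ := by gcongr
      _ = ‖(1 : A)‖ * ‖Y‖ ^ (n + 1) := by ring

theorem norm_pow_mul_mul_pow_le {Y : A} {R : ℝ} (hY : ‖Y‖ ≤ R) (Z : A) (m n : ℕ) :
    ‖Y ^ m * Z * Y ^ n‖ ≤ ‖(1 : A)‖ ^ 2 * R ^ (m + n) * ‖Z‖ := by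
  have hR : 0 ≤ R := (norm_nonneg Y).trans hY
  have key (k : ℕ) : ‖Y ^ k‖ ≤ ‖(1 : A)‖ * R ^ k :=
    (norm_pow_le_norm_one_mul Y k).trans (by gcongr)
  calc ‖Y ^ m * Z * Y ^ n‖ ≤ ‖Y ^ m‖ * ‖Z‖ * ‖Y ^ n‖ := norm_mul₃_le
    _ ≤ (‖(1 : A)‖ * R ^ m) * ‖Z‖ * (‖(1 : A)‖ * R ^ n) := by
      gcongr
      · exact key m
      · exact key n
    _ = ‖(1 : A)‖ ^ 2 * R ^ (m + n) * ‖Z‖ := by ring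

theorem summable_nat_mul_pow_pred_div_factorial (C R : ℝ) :
    Summable fun m : ℕ => ((m.factorial : ℝ))⁻¹ * (m * (C * R ^ (m - 1))) := by
  rw [← summable_nat_add_iff 1]
  refine ((Real.summable_pow_div_factorial R).mul_left C).congr fun m => ?_
  have : (m.factorial : ℝ) ≠ 0 := by positivity
  have : (m : ℝ) + 1 ≠ 0 := by positivity
  simp only [Nat.factorial_succ, add_tsub_cancel_right]
  push_cast
  field_simp

theorem tsum_prod_eq_tsum_sum_antidiagonal [CompleteSpace A] {f : ℕ × ℕ → A}
    (hf : Summable f) : ∑' p, f p = ∑' k, ∑ p ∈ antidiagonal k, f p := by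
  let e := HasAntidiagonal.sigmaAntidiagonalEquivProd (A := ℕ)
  have he : Summable fun x => f (e x) := e.summable_iff.mpr hf
  rw [← e.tsum_eq f, he.tsum_sigma]
  refine tsum_congr fun k => ?_
  rw [tsum_fintype]
  exact sum_coe_sort (antidiagonal k) f

variable [NormedAlgebra ℝ A]

/-- The derivative of `X ↦ X ^ m / (ℓ + m)!`. -/
noncomputable def gammaTermDeriv (ℓ m : ℕ) (Y : A) : A →L[ℝ] A :=
  ((ℓ + m).factorial : ℝ)⁻¹ •
    ∑ i ∈ range m, Y ^ (m.pred - i) •> ContinuousLinearMap.id ℝ A <• Y ^ i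

theorem gammaTermDeriv_apply (ℓ m : ℕ) (Y Z : A) :
    gammaTermDeriv ℓ m Y Z =
      ((ℓ + m).factorial : ℝ)⁻¹ • ∑ i ∈ range m, Y ^ (m.pred - i) * Z * Y ^ i := by
  simp [gammaTermDeriv, _root_.sum_apply, mul_assoc]

theorem norm_gammaTermDeriv_le (ℓ m : ℕ) {Y : A} {R : ℝ} (hY : ‖Y‖ ≤ R) :
    ‖gammaTermDeriv ℓ m Y‖ ≤ (m.factorial : ℝ)⁻¹ * (m * (‖(1 : A)‖ ^ 2 * R ^ (m - 1))) := by
  have hR : 0 ≤ R := (norm_nonneg Y).trans hY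
  refine ContinuousLinearMap.opNorm_le_bound _ (by positivity) fun Z => ?_
  have hsum : ‖∑ i ∈ range m, Y ^ (m.pred - i) * Z * Y ^ i‖ ≤
      m * (‖(1 : A)‖ ^ 2 * R ^ (m - 1) * ‖Z‖) := by
    calc _ ≤ ∑ _i ∈ range m, ‖(1 : A)‖ ^ 2 * R ^ (m - 1) * ‖Z‖ := by
          refine norm_sum_le_of_le _ fun i hi => ?_
          have hi : m.pred - i + i = m - 1 := by
            have := mem_range.mp hi
            rw [Nat.pred_eq_sub_one]
            omega
          simpa only [hi] using norm_pow_mul_mul_pow_le hY Z (m.pred - i) i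
      _ = _ := by simp
  have hfac : ((ℓ + m).factorial : ℝ)⁻¹ ≤ (m.factorial : ℝ)⁻¹ := by
    gcongr
    omega
  rw [gammaTermDeriv_apply, norm_smul, Real.norm_of_nonneg (by positivity)]
  calc _ ≤ (m.factorial : ℝ)⁻¹ * (m * (‖(1 : A)‖ ^ 2 * R ^ (m - 1) * ‖Z‖)) := by gcongr
    _ = _ := by ring

variable [CompleteSpace A]

theorem summable_gammaTermDeriv (ℓ : ℕ) (Y : A) : Summable fun m => gammaTermDeriv ℓ m Y :=
  .of_norm_bounded (summable_nat_mul_pow_pred_div_factorial _ _)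
    fun m => norm_gammaTermDeriv_le ℓ m le_rfl

theorem hasFDerivAt_gamma (ℓ : ℕ) (Y : A) :
    HasFDerivAt (Gamma ℓ) (∑' m, gammaTermDeriv ℓ m Y) Y := by
  have hR : 0 < ‖Y‖ + 1 := by positivity
  refine hasFDerivAt_tsum_of_isPreconnected (s := Metric.ball 0 (‖Y‖ + 1)) (x₀ := 0)
    (summable_nat_mul_pow_pred_div_factorial (‖(1 : A)‖ ^ 2) (‖Y‖ + 1)) Metric.isOpen_ball
    (convex_ball _ _).isPreconnected
    (fun m Z _ => (hasFDerivAt_pow' m).fun_const_smul _)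
    (fun m Z hZ => norm_gammaTermDeriv_le ℓ m (mem_ball_zero_iff.mp hZ).le)
    (Metric.mem_ball_self hR) ?_ (by simp)
  refine summable_of_ne_finset_zero (s := {0}) fun m hm => ?_
  rw [zero_pow (by simpa using hm), smul_zero]

theorem summable_gamma3_terms (ℓ : ℕ) (Y Z : A) :
    Summable fun p : ℕ × ℕ =>
      ((ℓ + p.1 + p.2 + 1).factorial : ℝ)⁻¹ • (Y ^ p.1 * Z * Y ^ p.2) := by
  have h := Real.summable_pow_div_factorial ‖Y‖
  refine .of_norm_bounded ((h.mul_of_nonneg h (fun _ => by positivity)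
    (fun _ => by positivity)).mul_left (‖(1 : A)‖ ^ 2 * ‖Z‖)) fun ⟨m, n⟩ => ?_
  have hfac : ((ℓ + m + n + 1).factorial : ℝ)⁻¹ ≤ ((m.factorial : ℝ) * n.factorial)⁻¹ := by
    gcongr
    have h₁ : m.factorial * n.factorial ≤ (m + n).factorial :=
      Nat.le_of_dvd (Nat.factorial_pos _) (Nat.factorial_mul_factorial_dvd_factorial_add m n)
    exact_mod_cast h₁.trans (Nat.factorial_le (by omega))
  rw [norm_smul, Real.norm_of_nonneg (by positivity)]
  calc _ ≤ ((m.factorial : ℝ) * n.factorial)⁻¹ * (‖(1 : A)‖ ^ 2 * ‖Y‖ ^ (m + n) * ‖Z‖) := by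
        gcongr
        exact norm_pow_mul_mul_pow_le le_rfl Z m n
    _ = _ := by
        rw [mul_inv, pow_add]
        ring

theorem tsum_gammaTermDeriv_apply (ℓ : ℕ) (Y Z : A) :
    (∑' m, gammaTermDeriv ℓ m Y) Z = Gamma3 ℓ Y Z Y := by
  have hs := summable_gammaTermDeriv ℓ Y
  have hsZ : Summable fun m => gammaTermDeriv ℓ m Y Z :=
    hs.map (ContinuousLinearMap.apply ℝ A Z) (ContinuousLinearMap.apply ℝ A Z).continuous
  have hp := summable_gamma3_terms ℓ Y Z
  calc (∑' m, gammaTermDeriv ℓ m Y) Z = ∑' m, gammaTermDeriv ℓ m Y Z :=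
        (ContinuousLinearMap.apply ℝ A Z).map_tsum hs
    _ = ∑' m, gammaTermDeriv ℓ (m + 1) Y Z := by
        rw [hsZ.tsum_eq_zero_add, gammaTermDeriv_apply]
        simp
    _ = ∑' k, ∑ p ∈ antidiagonal k,
          ((ℓ + p.1 + p.2 + 1).factorial : ℝ)⁻¹ • (Y ^ p.1 * Z * Y ^ p.2) := by
        refine tsum_congr fun k => ?_
        rw [gammaTermDeriv_apply, ← Nat.sum_antidiagonal_swap,
          Nat.sum_antidiagonal_eq_sum_range_succ_mk, smul_sum]
        refine sum_congr rfl fun i hi => ?_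
        have : ℓ + (k - i) + i + 1 = ℓ + (k + 1) := by
          have := mem_range.mp hi
          omega
        simp [this]
    _ = ∑' p : ℕ × ℕ, ((ℓ + p.1 + p.2 + 1).factorial : ℝ)⁻¹ • (Y ^ p.1 * Z * Y ^ p.2) :=
        (tsum_prod_eq_tsum_sum_antidiagonal hp).symm
    _ = Gamma3 ℓ Y Z Y := hp.tsum_prod

end GammaSeries

theorem hasDerivAt_gamma {A : Type*} [NormedRing A] [NormedAlgebra ℝ A] [CompleteSpace A]
    (ℓ : ℕ) (X : ℝ → A) (X' : A) (t : ℝ) (hX : HasDerivAt X X' t) :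
    HasDerivAt (fun s => Gamma ℓ (X s)) (Gamma3 ℓ (X t) X' (X t)) t := by
  rw [← tsum_gammaTermDeriv_apply]
  exact (hasFDerivAt_gamma ℓ (X t)).comp_hasDerivAt t hX
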